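/- The cotangent sum c₀(1/p) := -Σ_{k=1}^{p-1} (k/p)·cot(πk/p) satisfies, for every integer p ≥ 2, c₀(1/p) = (p(p-1)(p-2)/π) · Σ_{k≥0} (k + 1 - (p/2)⌊k/p⌋)(⌊k/p⌋ + 1) / ((k+1)(k+p+1)(k+2)(k+p)). -/

import Mathlib

open Real

/-- The cotangent sum `c₀(1/p) = -∑_{k=1}^{p-1} (k/p) cot (π k / p)`. -/
noncomputable def c₀ (p : ℕ) : ℝ :=
  -∑ k ∈ Finset.Icc 1 (p - 1), ((k : ℝ) / p) * Real.cot (π * k / p)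

open Filter Topology Finset

/-- The harmonic block `∑_{r < p} 1 / (p q + r + 1)`. -/
noncomputable def harmonicBlock (p q : ℕ) : ℝ :=
  ∑ r ∈ range p, 1 / ((p : ℝ) * q + r + 1)

lemma sum_range_mul_eq_sum_sum {M : Type*} [AddCommMonoid M] (f : ℕ → M) (p n : ℕ) :
    ∑ k ∈ range (p * n), f k = ∑ q ∈ range n, ∑ r ∈ range p, f (p * q + r) := by
  induction n with
  | zero => simp
  | succ n ih => rw [Nat.mul_succ, sum_range_add, ih, sum_range_succ]

lemma harmonicBlock_succ (p q : ℕ) :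
    ∑ r ∈ range p, 1 / ((p : ℝ) * q + r + 1 + p) = harmonicBlock p (q + 1) := by
  refine sum_congr rfl fun r _ => ?_
  push_cast
  ring_nf

lemma sum_one_div_shift (x : ℝ) (p : ℕ) :
    ∑ r ∈ range p, 1 / (x + r + 2) =
      ∑ r ∈ range p, 1 / (x + r + 1) - 1 / (x + 1) + 1 / (x + p + 1) := by
  have h := sum_range_succ (fun r : ℕ => 1 / (x + r + 1)) p
  rw [sum_range_succ'] at h
  have h' : ∑ r ∈ range p, 1 / (x + r + 2) = ∑ r ∈ range p, 1 / (x + (r + 1 : ℕ) + 1) :=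
    sum_congr rfl fun r _ => by push_cast; ring_nf
  simp only [Nat.cast_zero, add_zero] at h
  rw [h']
  linarith

lemma sum_harmonicBlock_succ_shift (p q : ℕ) :
    ∑ r ∈ range p, 1 / ((p : ℝ) * q + r + p) =
      harmonicBlock p (q + 1) + 1 / ((p : ℝ) * (q + 1)) - 1 / ((p : ℝ) * (q + 2)) := by
  have h := sum_one_div_shift ((p : ℝ) * (q + 1) - 1) p
  have h1 : ∑ r ∈ range p, 1 / ((p : ℝ) * (q + 1) - 1 + r + 2) = harmonicBlock p (q + 1) :=
    sum_congr rfl fun r _ => by push_cast; ring_nf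
  have h2 : ∑ r ∈ range p, 1 / ((p : ℝ) * (q + 1) - 1 + r + 1) =
      ∑ r ∈ range p, 1 / ((p : ℝ) * q + r + p) :=
    sum_congr rfl fun r _ => by ring_nf
  rw [h1, h2, show (p : ℝ) * (q + 1) - 1 + 1 = p * (q + 1) by ring,
    show (p : ℝ) * (q + 1) - 1 + p + 1 = p * (q + 2) by ring] at h
  linarith

lemma summand_partial_fractions {p x q : ℝ} (hp : 2 ≤ p) (hx : 0 ≤ x) :
    p * (p - 1) * (p - 2) * (((x + 1 - p / 2 * q) * (q + 1)) /
        ((x + 1) * (x + p + 1) * (x + 2) * (x + p))) =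
      (q + 1) * (p * ((p - 2) * (1 / (x + 1 + p)) - (p - 1) * (1 / (x + p)) + 1 / (x + 2)) -
        p * q / 2 * ((p - 2) * (1 / (x + 1) - 1 / (x + 1 + p)) -
          p * (1 / (x + 2) - 1 / (x + p)))) := by
  have h1 : x + 1 ≠ 0 := by positivity
  have h2 : x + p + 1 ≠ 0 := by positivity
  have h3 : x + 2 ≠ 0 := by positivity
  have h4 : x + p ≠ 0 := by positivity
  rw [show x + 1 + p = x + p + 1 by ring]
  field_simp
  ring

lemma sum_summand_block {p : ℕ} (hp : 2 ≤ p) (q : ℕ) :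
    ∑ r ∈ range p, (p : ℝ) * (p - 1) * (p - 2) *
        (((((p : ℝ) * q + r) + 1 - (p : ℝ) / 2 * q) * ((q : ℝ) + 1)) /
          ((((p : ℝ) * q + r) + 1) * (((p : ℝ) * q + r) + p + 1) * (((p : ℝ) * q + r) + 2) *
            (((p : ℝ) * q + r) + p))) =
      (q + 1) * (p * (harmonicBlock p q - harmonicBlock p (q + 1) - (p - 1) / p *
          (1 / ((q + 1) * (q + 2))) - 1 / (p * q + 1) + 1 / (p * (q + 1) + 1)) -
        p * q / 2 * (-2 * (harmonicBlock p q - harmonicBlock p (q + 1)) +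
          p * (1 / (p * q + 1) - 1 / (p * (q + 1) + 1)) + 1 / ((q + 1) * (q + 2)))) := by
  have hp' : (2 : ℝ) ≤ p := by exact_mod_cast hp
  have hp0 : (p : ℝ) ≠ 0 := by positivity
  have hx : ∀ r : ℕ, (0 : ℝ) ≤ p * q + r := fun r => by positivity
  refine (sum_congr rfl fun r _ => summand_partial_fractions hp' (hx r)).trans ?_
  have hs := sum_one_div_shift ((p : ℝ) * q) p
  change _ = harmonicBlock p q - _ + _ at hs
  simp only [← mul_sum, sum_add_distrib, sum_sub_distrib, harmonicBlock_succ,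
    sum_harmonicBlock_succ_shift, hs]
  change ((q : ℝ) + 1) * (p * _ - p * q / 2 * ((p - 2) * (harmonicBlock p q - _) - _)) = _
  have e : (p : ℝ) * q + p + 1 = p * (q + 1) + 1 := by ring
  rw [e]
  have h1 : (q : ℝ) + 1 ≠ 0 := by positivity
  have h2 : (q : ℝ) + 2 ≠ 0 := by positivity
  have h3 : 1 / ((p : ℝ) * (q + 1)) = 1 / p * (1 / (q + 1)) := by field_simp
  have h4 : 1 / ((p : ℝ) * (q + 2)) = 1 / p * (1 / (q + 2)) := by field_simp
  have h5 : 1 / (((q : ℝ) + 1) * (q + 2)) = 1 / (q + 1) - 1 / (q + 2) := by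
    field_simp; ring
  rw [h3, h4, h5]
  field_simp
  ring

lemma sum_cot_block {p : ℕ} (hp : 2 ≤ p) (m : ℕ) :
    ∑ k ∈ Ico 1 p, (k : ℝ) * (1 / ((p : ℝ) * m + k) - 1 / ((p : ℝ) * (m + 1) - k)) =
      2 * ((p : ℝ) - 1) - p * (2 * m + 1) * harmonicBlock p m + (2 * m + 1) / (m + 1) := by
  have hrefl : ∑ k ∈ Ico 1 p, (k : ℝ) * (1 / ((p : ℝ) * (m + 1) - k)) =
      ∑ k ∈ Ico 1 p, ((p : ℝ) - k) * (1 / ((p : ℝ) * m + k)) := by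
    refine sum_nbij' (fun k => p - k) (fun k => p - k) ?_ ?_ ?_ ?_ ?_
    · intro k hk; simp only [mem_Ico] at *; omega
    · intro k hk; simp only [mem_Ico] at *; omega
    · intro k hk; simp only [mem_Ico] at *; omega
    · intro k hk; simp only [mem_Ico] at *; omega
    · intro k hk
      simp only [mem_Ico] at hk
      rw [Nat.cast_sub hk.2.le]
      ring_nf
  have hsum : harmonicBlock p m =
      ∑ k ∈ Ico 1 p, 1 / ((p : ℝ) * m + k) + 1 / ((p : ℝ) * (m + 1)) := by
    obtain ⟨n, rfl⟩ : ∃ n, p = n + 1 := ⟨p - 1, by omega⟩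
    rw [harmonicBlock, sum_range_succ, sum_Ico_eq_sum_range]
    congr 1
    · refine sum_congr (by simp) fun r _ => ?_
      push_cast
      ring_nf
    · push_cast
      ring_nf
  simp only [mul_sub, sum_sub_distrib]
  rw [hrefl, ← sum_sub_distrib, hsum]
  have hp0 : (p : ℝ) ≠ 0 := by positivity
  have h : ∀ k ∈ Ico 1 p, (k : ℝ) * (1 / ((p : ℝ) * m + k)) - (p - k) * (1 / ((p : ℝ) * m + k)) =
      2 - p * (2 * m + 1) * (1 / ((p : ℝ) * m + k)) := by
    intro k hk
    have hk' : (0 : ℝ) < k := by exact_mod_cast (mem_Ico.1 hk).1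
    have : (p : ℝ) * m + k ≠ 0 := by positivity
    field_simp
    ring
  rw [sum_congr rfl h, sum_sub_distrib, ← mul_sum, sum_const, Nat.card_Ico, nsmul_eq_mul,
    Nat.cast_sub (by omega)]
  push_cast
  field_simp
  ring

/-- The difference between the partial sums of the two series up to `p n`. -/
noncomputable def blockError (p n : ℕ) : ℝ :=
  ∑ r ∈ range p, ((r : ℝ) + 1) * (n / (p * n + r + 1)) - 1 + 1 / (n + 1) +
    (1 - p) / 2 * (p * (n / (p * n + 1)))

lemma blockError_eq (p n : ℕ) :
    blockError p n = p * n - p * n ^ 2 * harmonicBlock p n - 1 + 1 / (n + 1) +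
      (1 - p) / 2 * (p * (n / (p * n + 1))) := by
  have h : ∀ r ∈ range p, ((r : ℝ) + 1) * (n / (p * n + r + 1)) =
      n - p * n ^ 2 * (1 / ((p : ℝ) * n + r + 1)) := by
    intro r _
    have : (p : ℝ) * n + r + 1 ≠ 0 := by positivity
    field_simp
    ring
  rw [blockError, sum_congr rfl h, sum_sub_distrib, ← mul_sum, harmonicBlock]
  simp

lemma tendsto_natCast_div_mul_add {p : ℝ} (hp : 0 < p) (b : ℝ) :
    Tendsto (fun n : ℕ => (n : ℝ) / (p * n + b)) atTop (𝓝 (1 / p)) := by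
  have h := (tendsto_natCast_div_add_atTop (b / p)).const_mul (1 / p)
  rw [mul_one] at h
  refine h.congr fun n => ?_
  rw [show p * (n : ℝ) + b = p * (n + b / p) by field_simp]
  rw [div_mul_div_comm, one_mul]

lemma tendsto_blockError {p : ℕ} (hp : 0 < p) :
    Tendsto (blockError p) atTop (𝓝 0) := by
  have hp' : (0 : ℝ) < p := by exact_mod_cast hp
  have h1 : Tendsto (fun n : ℕ => ∑ r ∈ range p, ((r : ℝ) + 1) * ((n : ℝ) / (p * n + r + 1)))
      atTop (𝓝 (∑ r ∈ range p, ((r : ℝ) + 1) * (1 / p))) := by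
    refine tendsto_finsetSum _ fun r _ => Tendsto.const_mul _ ?_
    simpa only [add_assoc] using tendsto_natCast_div_mul_add hp' ((r : ℝ) + 1)
  have h2 := (h1.sub_const 1).add (tendsto_one_div_add_atTop_nhds_zero_nat (𝕜 := ℝ))
  have h3 := h2.add (((tendsto_natCast_div_mul_add hp' 1).const_mul (p : ℝ)).const_mul
    ((1 - (p : ℝ)) / 2))
  have hs : ∀ n : ℕ, ∑ r ∈ range n, ((r : ℝ) + 1) = n * (n + 1) / 2 := by
    intro n
    induction n with
    | zero => simp
    | succ n ih => rw [sum_range_succ, ih]; push_cast; ring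
  rw [← sum_mul, hs] at h3
  have e : (p : ℝ) * (p + 1) / 2 * (1 / p) - 1 + 0 + (1 - p) / 2 * (p * (1 / p)) = 0 := by
    field_simp
    ring
  rwa [e] at h3

lemma sum_summand_block_eq {p : ℕ} (hp : 2 ≤ p) (q : ℕ) :
    ∑ r ∈ range p, (p : ℝ) * (p - 1) * (p - 2) *
        (((((p : ℝ) * q + r) + 1 - (p : ℝ) / 2 * q) * ((q : ℝ) + 1)) /
          ((((p : ℝ) * q + r) + 1) * (((p : ℝ) * q + r) + p + 1) * (((p : ℝ) * q + r) + 2) *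
            (((p : ℝ) * q + r) + p))) =
      -∑ k ∈ Ico 1 p, (k : ℝ) * (1 / ((p : ℝ) * q + k) - 1 / ((p : ℝ) * (q + 1) - k)) +
        (blockError p (q + 1) - blockError p q) := by
  rw [sum_summand_block hp, sum_cot_block hp, blockError_eq, blockError_eq]
  have hp0 : (p : ℝ) ≠ 0 := by positivity
  have h0 : (q : ℝ) + 1 ≠ 0 := by positivity
  have h1 : (q : ℝ) + 2 ≠ 0 := by positivity
  have h2 : (q : ℝ) + 1 + 1 ≠ 0 := by positivity
  have h3 : (p : ℝ) * q + 1 ≠ 0 := by positivity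
  have h4 : (p : ℝ) * (q + 1) + 1 ≠ 0 := by positivity
  push_cast
  rw [show (q : ℝ) + 1 + 1 = q + 2 by ring]
  field_simp
  ring

lemma tendsto_sum_cot_terms {p k : ℕ} (hk : k ∈ Ico 1 p) :
    Tendsto (fun n : ℕ => ∑ m ∈ range n, (1 / ((p : ℝ) * m + k) - 1 / ((p : ℝ) * (m + 1) - k)))
      atTop (𝓝 (π / p * Real.cot (π * k / p))) := by
  obtain ⟨hk1, hkp⟩ := mem_Ico.1 hk
  have hk0 : (0 : ℝ) < k := by exact_mod_cast hk1
  have hp0 : (0 : ℝ) < p := by exact_mod_cast hk1.trans hkp.le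
  have hkp' : (k : ℝ) < p := by exact_mod_cast hkp
  set x : ℝ := k / p with hx
  have hx0 : 0 < x := by positivity
  have hx1 : x < 1 := by rw [hx, div_lt_one hp0]; exact hkp'
  have hxc : (x : ℂ) ∈ Complex.integerComplement := by
    rintro ⟨n, hn⟩
    have hn' : (n : ℝ) = x := by exact_mod_cast hn
    rw [← hn'] at hx0 hx1
    have a : (0 : ℤ) < n := by exact_mod_cast hx0
    have b : n < (1 : ℤ) := by exact_mod_cast hx1
    omega
  have h := tendsto_logDeriv_euler_cot_sub hxc
  have hr : Tendsto (fun n : ℕ => ∑ j ∈ range n, (1 / (x - (j + 1)) + 1 / (x + (j + 1))))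
      atTop (𝓝 (π * Real.cot (π * x) - 1 / x)) := by
    have h' := (Complex.continuous_re.tendsto _).comp h
    have e : (π * Complex.cot (π * x) - 1 / x : ℂ) =
        ((π * Real.cot (π * x) - 1 / x : ℝ) : ℂ) := by push_cast; rfl
    rw [e, Complex.ofReal_re] at h'
    refine h'.congr fun n => ?_
    have e' : ∑ j ∈ range n, cotTerm x j =
        ((∑ j ∈ range n, (1 / (x - (j + 1)) + 1 / (x + (j + 1))) : ℝ) : ℂ) := by
      push_cast; rfl
    simp only [Function.comp_apply, e', Complex.ofReal_re]
  have hz : Tendsto (fun n : ℕ => 1 / (x + n)) atTop (𝓝 0) := by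
    simp only [one_div]
    exact (tendsto_atTop_add_const_left _ _ tendsto_natCast_atTop_atTop).inv_tendsto_atTop
  have hfin := (((hr.add_const (1 / x)).sub hz).const_mul (1 / (p : ℝ)))
  have el : 1 / (p : ℝ) * (π * Real.cot (π * x) - 1 / x + 1 / x - 0) =
      π / p * Real.cot (π * k / p) := by
    rw [hx, mul_div_assoc]; ring
  rw [el] at hfin
  refine hfin.congr fun n => ?_
  have hterm : ∀ m : ℕ, 1 / ((p : ℝ) * m + k) - 1 / ((p : ℝ) * (m + 1) - k) =
      1 / (p : ℝ) * (1 / (x + m) + 1 / (x - (m + 1))) := by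
    intro m
    have e1 : (p : ℝ) * m + k = p * (x + m) := by rw [hx]; field_simp; ring
    have e2 : (p : ℝ) * (m + 1) - k = -(p * (x - (m + 1))) := by rw [hx]; field_simp; ring
    rw [e1, e2, one_div_neg_eq_neg_one_div, ← one_div_mul_one_div, ← one_div_mul_one_div]
    ring
  rw [sum_congr rfl fun m _ => hterm m, ← mul_sum]
  congr 1
  induction n with
  | zero => simp
  | succ n ih =>
    rw [sum_range_succ, sum_range_succ, ← ih]
    push_cast
    ring

lemma tendsto_sum_cot_blocks {p : ℕ} (hp : 2 ≤ p) :
    Tendsto (fun n : ℕ => ∑ m ∈ range n,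
        ∑ k ∈ Ico 1 p, (k : ℝ) * (1 / ((p : ℝ) * m + k) - 1 / ((p : ℝ) * (m + 1) - k)))
      atTop (𝓝 (-(π * c₀ p))) := by
  have h := tendsto_finsetSum (Ico 1 p) fun k hk =>
    (tendsto_sum_cot_terms hk).const_mul (k : ℝ)
  have e : ∑ k ∈ Ico 1 p, (k : ℝ) * (π / p * Real.cot (π * k / p)) = -(π * c₀ p) := by
    have hI : Icc 1 (p - 1) = Ico 1 p := by
      ext k; simp only [mem_Icc, mem_Ico]; omega
    rw [c₀, hI, mul_neg, neg_neg, mul_sum]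
    exact sum_congr rfl fun k _ => by ring
  rw [e] at h
  refine h.congr fun n => ?_
  rw [sum_comm]
  exact sum_congr rfl fun k _ => by rw [mul_sum]

lemma summable_c₀_summand {p : ℕ} (hp : 2 ≤ p) :
    Summable fun k : ℕ =>
      (((k : ℝ) + 1 - (p : ℝ) / 2 * ((k / p : ℕ) : ℝ)) * (((k / p : ℕ) : ℝ) + 1)) /
        (((k : ℝ) + 1) * ((k : ℝ) + p + 1) * ((k : ℝ) + 2) * ((k : ℝ) + p)) := by
  have hs : Summable fun k : ℕ => 1 / ((k + 1 : ℕ) : ℝ) ^ 2 :=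
    (summable_nat_add_iff 1).2 (Real.summable_one_div_nat_pow.2 one_lt_two)
  have hp' : (2 : ℝ) ≤ p := by exact_mod_cast hp
  have hq : ∀ k : ℕ, (p : ℝ) * ((k / p : ℕ) : ℝ) ≤ k := fun k => by
    exact_mod_cast Nat.mul_div_le k p
  have hN : ∀ k : ℕ, 0 ≤ (k : ℝ) + 1 - (p : ℝ) / 2 * ((k / p : ℕ) : ℝ) := fun k => by
    have := hq k
    have : (0 : ℝ) ≤ k := k.cast_nonneg
    linarith
  refine Summable.of_nonneg_of_le (fun k => ?_) (fun k => ?_) hs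
  · have := hN k
    positivity
  · have h1 : (k : ℝ) + 1 - (p : ℝ) / 2 * ((k / p : ℕ) : ℝ) ≤ k + 1 := by
      have : 0 ≤ (p : ℝ) / 2 * ((k / p : ℕ) : ℝ) := by positivity
      linarith
    have h2 : ((k / p : ℕ) : ℝ) + 1 ≤ k + 1 := by
      have : ((k / p : ℕ) : ℝ) ≤ k := by exact_mod_cast Nat.div_le_self k p
      linarith
    rw [div_le_div_iff₀ (by positivity) (by positivity), one_mul]
    push_cast
    have hk : (0 : ℝ) ≤ k := k.cast_nonneg
    calc _ ≤ (((k : ℝ) + 1) * (k + 1)) * (k + 1) ^ 2 := by gcongr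
      _ = ((k : ℝ) + 1) * (k + 1) * (k + 1) * (k + 1) := by ring
      _ ≤ _ := by gcongr <;> linarith

theorem c0_series (p : ℕ) (hp : 2 ≤ p) :
    c₀ p = (p * ((p : ℝ) - 1) * ((p : ℝ) - 2) / π) *
      ∑' k : ℕ,
        (((k : ℝ) + 1 - (p : ℝ) / 2 * ((k / p : ℕ) : ℝ)) * (((k / p : ℕ) : ℝ) + 1)) /
          (((k : ℝ) + 1) * ((k : ℝ) + p + 1) * ((k : ℝ) + 2) * ((k : ℝ) + p)) := by
  have hp0 : 0 < p := by omega
  have hlim := (((summable_c₀_summand hp).hasSum.mul_left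
    ((p : ℝ) * (p - 1) * (p - 2))).tendsto_sum_nat).comp (tendsto_id.const_mul_atTop' hp0)
  have hcot := (tendsto_sum_cot_blocks hp).neg.add
    ((tendsto_blockError hp0).sub_const (blockError p 0))
  have h0 : blockError p 0 = 0 := by simp [blockError]
  rw [neg_neg, h0, sub_zero, add_zero] at hcot
  have key := tendsto_nhds_unique (hlim.congr fun n => ?_) hcot
  · rw [div_mul_eq_mul_div, key, mul_div_cancel_left₀ _ Real.pi_ne_zero]
  · simp only [Function.comp_apply, id]
    rw [sum_range_mul_eq_sum_sum, ← sum_neg_distrib, ← h0, ← sum_range_sub, ← sum_add_distrib]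
    refine sum_congr rfl fun q _ => ?_
    rw [← sum_summand_block_eq hp q]
    refine sum_congr rfl fun r hr => ?_
    have hdiv : (p * q + r) / p = q := by
      rw [Nat.mul_add_div hp0, Nat.div_eq_of_lt (mem_range.1 hr), add_zero]
    rw [hdiv]
    push_cast
    rfl
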